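/- Let n ≥ 1 and 0 < β < 1/2. Let ψ : ℝⁿ → ℝ be bounded and Lipschitz. For a Schwartz function f on ℝⁿ define (T f)(v) = ∫_{ℝⁿ} (ψ(v) − ψ(z)) f(z) / |v − z|^{n + 2β} dz. Then there is a constant C > 0, depending only on n, β, the sup-norm of ψ and the Lipschitz constant of ψ, such that ‖T f‖_{L²(ℝⁿ)} ≤ C ‖f‖_{L²(ℝⁿ)} for every Schwartz f. -/

import Mathlib

open MeasureTheory

noncomputable section

/-- The commutator operator `(T f)(v) = ∫ (ψ(v) - ψ(z)) f(z) / |v - z|^{n+2β} dz`. -/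
def commOp (n : ℕ) (β : ℝ) (ψ : EuclideanSpace ℝ (Fin n) → ℝ)
    (f : EuclideanSpace ℝ (Fin n) → ℂ) (v : EuclideanSpace ℝ (Fin n)) : ℂ :=
  ∫ z : EuclideanSpace ℝ (Fin n),
    ((ψ v - ψ z : ℝ) : ℂ) * f z / ((‖v - z‖ ^ ((n : ℝ) + 2 * β) : ℝ) : ℂ)

/-- L² norm on ℝⁿ. -/
def l2n (n : ℕ) (u : EuclideanSpace ℝ (Fin n) → ℂ) : ℝ :=
  (∫ v : EuclideanSpace ℝ (Fin n), ‖u v‖ ^ 2) ^ ((1 : ℝ) / 2)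

lemma cs_aux {α : Type*} [MeasurableSpace α] (μ : Measure α) (K F : α → ENNReal)
    (hK : Measurable K) (hF : Measurable F) :
    (∫⁻ z, K z * F z ∂μ) ^ 2 ≤ (∫⁻ z, K z ∂μ) * ∫⁻ z, K z * F z ^ 2 ∂μ := by
  have h := ENNReal.lintegral_mul_le_Lp_mul_Lq μ (p := 2) (q := 2)
    Real.HolderConjugate.two_two
    (f := fun z => K z ^ (1 / 2 : ℝ)) (g := fun z => K z ^ (1 / 2 : ℝ) * F z)
    (by fun_prop) (by fun_prop)
  have e1 : ∀ z, K z ^ (1 / 2 : ℝ) * K z ^ (1 / 2 : ℝ) = K z := fun z => by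
    rw [← ENNReal.rpow_add_of_nonneg _ _ (by norm_num) (by norm_num)]; norm_num
  have e2 : ∀ z, (K z ^ (1 / 2 : ℝ)) ^ (2 : ℝ) = K z := fun z => by
    rw [← ENNReal.rpow_mul]; norm_num
  have e3 : ∀ z, (K z ^ (1 / 2 : ℝ) * F z) ^ (2 : ℝ) = K z * F z ^ 2 := fun z => by
    rw [ENNReal.mul_rpow_of_nonneg _ _ (by norm_num), e2]; norm_cast
  simp only [Pi.mul_apply, ← mul_assoc, e1, e2, e3] at h
  have h2 := pow_le_pow_left₀ (by positivity) h 2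
  refine h2.trans (le_of_eq ?_)
  rw [mul_pow]
  have e4 : ∀ x : ENNReal, (x ^ (1 / 2 : ℝ)) ^ 2 = x := fun x => by
    rw [← ENNReal.rpow_natCast, ← ENNReal.rpow_mul]; norm_num
  rw [e4, e4]

/-- Schur type bound for a convolution kernel. -/
lemma schur_aux {E : Type*} [NormedAddCommGroup E] [MeasurableSpace E] [BorelSpace E]
    [SecondCountableTopology E] (μ : Measure E) [SFinite μ] [μ.IsAddHaarMeasure]
    [μ.IsNegInvariant]
    (K F : E → ENNReal) (hK : Measurable K) (hF : Measurable F) :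
    ∫⁻ v, (∫⁻ z, K (v - z) * F z ∂μ) ^ 2 ∂μ ≤ (∫⁻ h, K h ∂μ) ^ 2 * ∫⁻ z, F z ^ 2 ∂μ := by
  calc ∫⁻ v, (∫⁻ z, K (v - z) * F z ∂μ) ^ 2 ∂μ
      ≤ ∫⁻ v, (∫⁻ h, K h ∂μ) * ∫⁻ z, K (v - z) * F z ^ 2 ∂μ ∂μ := by
        refine lintegral_mono fun v => ?_
        refine (cs_aux μ (fun z => K (v - z)) F (by fun_prop) hF).trans (le_of_eq ?_)
        rw [lintegral_sub_left_eq_self K v]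
    _ = (∫⁻ h, K h ∂μ) * ∫⁻ v, ∫⁻ z, K (v - z) * F z ^ 2 ∂μ ∂μ := by
        rw [lintegral_const_mul]
        exact Measurable.lintegral_prod_right' (f := fun p : E × E => K (p.1 - p.2) * F p.2 ^ 2)
          (by fun_prop)
    _ = (∫⁻ h, K h ∂μ) * ∫⁻ z, ∫⁻ v, K (v - z) * F z ^ 2 ∂μ ∂μ := by
        rw [lintegral_lintegral_swap]
        apply Measurable.aemeasurable
        simp only [Function.uncurry_def]
        fun_prop
    _ = (∫⁻ h, K h ∂μ) * ∫⁻ z, (∫⁻ h, K h ∂μ) * F z ^ 2 ∂μ := by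
        congr 1
        refine lintegral_congr fun z => ?_
        rw [lintegral_mul_const _ (by fun_prop), lintegral_sub_right_eq_self K z]
    _ = _ := by
        rw [lintegral_const_mul _ (by fun_prop), sq, mul_assoc]

/-- Radial majorant of the kernel. -/
def kerMaj (n : ℕ) (β L M : ℝ) (y : ℝ) : ℝ :=
  if y ≤ 1 then L * y ^ (1 - ((n : ℝ) + 2 * β)) else 2 * M * y ^ (-((n : ℝ) + 2 * β))

lemma kerMaj_measurable (n : ℕ) (β L M : ℝ) : Measurable (kerMaj n β L M) := by
  unfold kerMaj
  refine Measurable.ite measurableSet_Iic ?_ ?_ <;> fun_prop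

lemma kerMaj_integrable (n : ℕ) (hn : 1 ≤ n) (β : ℝ)
    (hβ0 : 0 < β) (hβ1 : β < 1 / 2) (L M : ℝ) :
    Integrable (fun h : EuclideanSpace ℝ (Fin n) => kerMaj n β L M ‖h‖) := by
  haveI : Nonempty (Fin n) := ⟨⟨0, hn⟩⟩
  rw [integrable_fun_norm_addHaar volume (f := kerMaj n β L M)]
  rw [finrank_euclideanSpace_fin, ← Set.Ioc_union_Ioi_eq_Ioi (zero_le_one (α := ℝ))]
  refine IntegrableOn.union ?_ ?_
  · have h : IntegrableOn (fun y : ℝ => L * y ^ (-(2 * β))) (Set.Ioc 0 1) := by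
      have := (intervalIntegral.intervalIntegrable_rpow' (a := 0) (b := 1) (r := -(2 * β))
        (by linarith))
      rw [intervalIntegrable_iff_integrableOn_Ioc_of_le zero_le_one] at this
      exact this.const_mul L
    refine h.congr_fun ?_ measurableSet_Ioc
    intro y hy
    simp only [kerMaj, if_pos hy.2, smul_eq_mul]
    rw [← Real.rpow_natCast, mul_left_comm, ← Real.rpow_add hy.1]
    congr 2
    push_cast [Nat.cast_sub hn]
    ring
  · have h : IntegrableOn (fun y : ℝ => 2 * M * y ^ (-1 - 2 * β)) (Set.Ioi 1) :=
      (integrableOn_Ioi_rpow_of_lt (by linarith) one_pos).const_mul _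
    refine h.congr_fun ?_ measurableSet_Ioi
    intro y hy
    have hy' : 1 < y := hy
    simp only [kerMaj, if_neg (not_le.2 hy'), smul_eq_mul]
    rw [← Real.rpow_natCast, mul_left_comm, ← Real.rpow_add (by linarith)]
    congr 2
    push_cast [Nat.cast_sub hn]
    ring

lemma ker_bound (n : ℕ) (β : ℝ) (L M : NNReal) (ψ : EuclideanSpace ℝ (Fin n) → ℝ)
    (hL : LipschitzWith L ψ) (hM : ∀ v, |ψ v| ≤ M) (v z : EuclideanSpace ℝ (Fin n)) :
    |ψ v - ψ z| / ‖v - z‖ ^ ((n : ℝ) + 2 * β) ≤ kerMaj n β L M ‖v - z‖ := by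
  rcases eq_or_ne v z with rfl | hvz
  · simp only [sub_self, abs_zero, zero_div, norm_zero, kerMaj, zero_le_one, if_true]
    positivity
  have hpos : 0 < ‖v - z‖ := norm_pos_iff.2 (sub_ne_zero.2 hvz)
  unfold kerMaj
  split_ifs with h
  · rw [Real.rpow_sub hpos, Real.rpow_one, ← mul_div_assoc]
    gcongr
    have := hL.dist_le_mul v z
    rwa [Real.dist_eq, dist_eq_norm] at this
  · rw [Real.rpow_neg hpos.le, ← div_eq_mul_inv]
    gcongr
    have := abs_sub (ψ v) (ψ z)
    linarith [hM v, hM z]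

/-- `L²` boundedness of the commutator of a bounded Lipschitz function with the
fractional Laplacian, in its integral form, for `0 < β < 1/2`. -/
theorem commutator_L2_bounded (n : ℕ) (hn : 1 ≤ n) (β : ℝ)
    (hβ0 : 0 < β) (hβ1 : β < 1 / 2) (L M : NNReal) :
    ∃ C > 0, ∀ ψ : EuclideanSpace ℝ (Fin n) → ℝ,
      LipschitzWith L ψ → (∀ v, |ψ v| ≤ M) →
      ∀ f : SchwartzMap (EuclideanSpace ℝ (Fin n)) ℂ,
        l2n n (commOp n β ψ f) ≤ C * l2n n f := by
  set K : EuclideanSpace ℝ (Fin n) → ENNReal :=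
    fun h => ENNReal.ofReal (kerMaj n β L M ‖h‖) with hKdef
  have hKm : Measurable K :=
    ((kerMaj_measurable n β L M).comp measurable_norm).ennreal_ofReal
  set A : ENNReal := ∫⁻ h, K h with hA
  have hAfin : A ≠ ⊤ :=
    ((kerMaj_integrable n hn β hβ0 hβ1 L M).lintegral_lt_top).ne
  refine ⟨A.toReal + 1, by positivity, ?_⟩
  intro ψ hL hM f
  have hfm : Measurable (fun z => ‖f z‖ₑ) := f.continuous.measurable.enorm
  have hpt : ∀ v, ‖commOp n β ψ f v‖ₑ ≤ ∫⁻ z, K (v - z) * ‖f z‖ₑ := by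
    intro v
    refine (enorm_integral_le_lintegral_enorm _).trans (lintegral_mono fun z => ?_)
    rw [← ofReal_norm, ← ofReal_norm (f z), hKdef]
    have hk := ker_bound n β L M ψ hL hM v z
    rw [← ENNReal.ofReal_mul (le_trans (by positivity) hk)]
    apply ENNReal.ofReal_le_ofReal
    rw [norm_div, norm_mul, Complex.norm_real, Complex.norm_real, Real.norm_eq_abs,
      Real.norm_of_nonneg (by positivity : 0 ≤ ‖v - z‖ ^ ((n : ℝ) + 2 * β)), mul_div_right_comm]
    gcongr
  have hmain : ∫⁻ v, ‖commOp n β ψ f v‖ₑ ^ 2 ≤ A ^ 2 * ∫⁻ z, ‖f z‖ₑ ^ 2 :=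
    (lintegral_mono fun v => pow_le_pow_left₀ (by positivity) (hpt v) 2).trans
      (schur_aux volume K _ hKm hfm)
  have hconv : ∀ x : ℂ, ENNReal.ofReal (‖x‖ ^ 2) = ‖x‖ₑ ^ 2 := fun x => by
    rw [ENNReal.ofReal_pow (norm_nonneg _), ofReal_norm]
  have hfint : Integrable (fun z => ‖f z‖ ^ 2) := by
    have := (f.memLp 2 volume).integrable_norm_pow (by norm_num)
    simpa using this
  have hf2 : ∫⁻ z, ‖f z‖ₑ ^ 2 = ENNReal.ofReal (∫ z, ‖f z‖ ^ 2) := by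
    rw [ofReal_integral_eq_lintegral_ofReal hfint (ae_of_all _ fun z => by positivity)]
    simp only [hconv]
  have hI : 0 ≤ ∫ z, ‖f z‖ ^ 2 := integral_nonneg fun z => by positivity
  have hle : ∫ v, ‖commOp n β ψ f v‖ ^ 2 ≤ A.toReal ^ 2 * ∫ z, ‖f z‖ ^ 2 := by
    have h1 := norm_integral_le_lintegral_norm (μ := volume) (fun v => ‖commOp n β ψ f v‖ ^ 2)
    simp only [norm_pow, norm_norm, hconv] at h1
    refine (le_abs_self _).trans (h1.trans ?_)
    rw [hf2] at hmain
    refine (ENNReal.toReal_mono (by finiteness) hmain).trans (le_of_eq ?_)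
    rw [ENNReal.toReal_mul, ENNReal.toReal_pow, ENNReal.toReal_ofReal hI]
  unfold l2n
  rw [← Real.sqrt_eq_rpow, ← Real.sqrt_eq_rpow]
  calc √(∫ v, ‖commOp n β ψ f v‖ ^ 2) ≤ √(A.toReal ^ 2 * ∫ z, ‖f z‖ ^ 2) := Real.sqrt_le_sqrt hle
    _ = A.toReal * √(∫ z, ‖f z‖ ^ 2) := by
      rw [Real.sqrt_mul (by positivity), Real.sqrt_sq (by positivity)]
    _ ≤ _ := by gcongr; linarith
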